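/- arXiv:2512.19499 — 3 statements merged into one kernel-verified Lean document; each statement's English description precedes it below -/
import Mathlib

section
/- Assume the restriction F : D → Y is proper, and let T_D be a domain tile. Then F(T_D) is an image tile T_C; the restriction of F to T_D, viewed as a map from T_D onto T_C, is a covering map; for every y ∈ T_C the fiber T_D ∩ F⁻¹({y}) is finite and nonempty; and the cardinality of this fiber is the same for all y ∈ T_C. -/
open Set Topology

/-- `x` is a regular point of `F : U → Y`: `F` maps some open neighborhood of `x`
(contained in `U`) homeomorphically onto an open subset of `Y`. -/
def IsRegularAt {X Y : Type*} [TopologicalSpace X] [TopologicalSpace Y]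
    (F : X → Y) (U : Set X) (x : X) : Prop :=
  ∃ V : Set X, IsOpen V ∧ x ∈ V ∧ V ⊆ U ∧ IsOpen (F '' V) ∧
    ∃ e : ↥V ≃ₜ ↥(F '' V), ∀ v : ↥V, (e v : Y) = F v

/-- The critical set of the restriction `F : D → Y`: critical points of `F : U → Y`
lying in `D`. -/
def criticalSet {X Y : Type*} [TopologicalSpace X] [TopologicalSpace Y]
    (F : X → Y) (U D : Set X) : Set X :=
  {x ∈ D | ¬ IsRegularAt F U x}

/-- The flower `𝓕 = D ∩ F⁻¹(F(C ∪ ∂D))`. -/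
def flower {X Y : Type*} [TopologicalSpace X] [TopologicalSpace Y]
    (F : X → Y) (U D : Set X) : Set X :=
  D ∩ F ⁻¹' (F '' (criticalSet F U D ∪ frontier D))

/-- A domain tile: a connected component of `D \ 𝓕`. -/
def IsDomainTile {X Y : Type*} [TopologicalSpace X] [TopologicalSpace Y]
    (F : X → Y) (U D : Set X) (T : Set X) : Prop :=
  ∃ x ∈ D \ flower F U D, T = connectedComponentIn (D \ flower F U D) x

/-- An image tile: a connected component of `Y \ F(C ∪ ∂D)`. -/
def IsImageTile {X Y : Type*} [TopologicalSpace X] [TopologicalSpace Y]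
    (F : X → Y) (U D : Set X) (T : Set Y) : Prop :=
  ∃ y ∈ (F '' (criticalSet F U D ∪ frontier D))ᶜ,
    T = connectedComponentIn (F '' (criticalSet F U D ∪ frontier D))ᶜ y

theorem isOpenEmbedding_domRestrict_of_homeomorph_image {X Y : Type*} [TopologicalSpace X]
    [TopologicalSpace Y] {F : X → Y} {V : Set X} (hFV : IsOpen (F '' V))
    (e : ↥V ≃ₜ ↥(F '' V)) (he : ∀ v : ↥V, (e v : Y) = F v) :
    IsOpenEmbedding (V.domRestrict F) := by
  have h : V.domRestrict F = Subtype.val ∘ e := funext fun v ↦ (he v).symm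
  rw [h]
  exact hFV.isOpenEmbedding_subtypeVal.comp e.isOpenEmbedding

theorem isLocalHomeomorphOn_of_isRegularAt {X Y : Type*} [TopologicalSpace X]
    [TopologicalSpace Y] {F : X → Y} {U s : Set X} (h : ∀ x ∈ s, IsRegularAt F U x) :
    IsLocalHomeomorphOn F s := by
  rw [isLocalHomeomorphOn_iff_isOpenEmbedding_restrict]
  intro x hx
  obtain ⟨V, hV, hxV, -, hFV, e, he⟩ := h x hx
  exact ⟨V, hV.mem_nhds hxV, isOpenEmbedding_domRestrict_of_homeomorph_image hFV e he⟩

theorem isOpen_setOf_isRegularAt {X Y : Type*} [TopologicalSpace X] [TopologicalSpace Y]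
    (F : X → Y) (U : Set X) : IsOpen {x | IsRegularAt F U x} := by
  refine isOpen_iff_forall_mem_open.mpr fun x ⟨V, hV, hxV, h⟩ ↦ ?_
  exact ⟨V, fun z hz ↦ ⟨V, hV, hz, h⟩, hV, hxV⟩

theorem isClosed_criticalSet {X Y : Type*} [TopologicalSpace X] [TopologicalSpace Y]
    (F : X → Y) (U : Set X) {D : Set X} (hD : IsClosed D) : IsClosed (criticalSet F U D) :=
  hD.inter (isOpen_setOf_isRegularAt F U).isClosed_compl

/-- A map that is proper on a closed set `D` sends closed subsets of `D` to closed sets. -/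
theorem isClosed_image_of_isCompact_inter_preimage {X Y : Type*} [TopologicalSpace X]
    [TopologicalSpace Y] [T2Space Y] [CompactlyCoherentSpace Y] {F : X → Y} {D S : Set X}
    (hF : ContinuousOn F D)
    (hproper : ∀ K : Set Y, IsCompact K → IsCompact (D ∩ F ⁻¹' K))
    (hS : IsClosed S) (hSD : S ⊆ D) : IsClosed (F '' S) := by
  have hp : IsProperMap (F ∘ ((↑) : D → X)) := by
    refine isProperMap_iff_isCompact_preimage.mpr
      ⟨hF.comp_continuous continuous_subtype_val Subtype.prop, fun K hK ↦ ?_⟩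
    rw [Subtype.isCompact_iff, preimage_comp, Subtype.image_preimage_coe]
    exact hproper K hK
  have h := hp.isClosedMap _ (hS.preimage (continuous_subtype_val (p := (· ∈ D))))
  rwa [image_comp, Subtype.image_preimage_coe, inter_eq_right.mpr hSD] at h

/-- A connected component of a set is relatively closed in it. -/
theorem closure_connectedComponentIn_inter_subset {X : Type*} [TopologicalSpace X]
    (A : Set X) {x : X} (hx : x ∈ A) :
    closure (connectedComponentIn A x) ∩ A ⊆ connectedComponentIn A x := by
  refine IsPreconnected.subset_connectedComponentIn
    (isPreconnected_connectedComponentIn.subset_closure ?_ inter_subset_left)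
    ⟨subset_closure (mem_connectedComponentIn hx), hx⟩ inter_subset_right
  exact subset_inter subset_closure (connectedComponentIn_subset A x)

theorem IsLocalHomeomorphOn.isLocalHomeomorph_mapsTo_restrict {X Y : Type*}
    [TopologicalSpace X] [TopologicalSpace Y] {F : X → Y} {s : Set X} {t : Set Y}
    (hF : IsLocalHomeomorphOn F s) (hs : IsOpen s) (ht : IsOpen t) (hm : MapsTo F s t) :
    IsLocalHomeomorph (hm.restrict F s t) := by
  have hcomp : IsLocalHomeomorph (F ∘ ((↑) : s → X)) :=
    isLocalHomeomorph_iff_isLocalHomeomorphOn_univ.mpr <|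
      hF.comp hs.isOpenEmbedding_subtypeVal.isLocalHomeomorph.isLocalHomeomorphOn
        fun x _ ↦ x.2
  exact IsLocalHomeomorph.of_comp (g := ((↑) : t → Y)) hcomp
    ht.isOpenEmbedding_subtypeVal.isLocalHomeomorph (hF.continuousOn.mapsToRestrict hm)

theorem IsLocalHomeomorph.finite_fiber_of_isProperMap {E B : Type*} [TopologicalSpace E]
    [TopologicalSpace B] {p : E → B} (hp : IsLocalHomeomorph p) (hprop : IsProperMap p) (b : B) :
    (p ⁻¹' {b}).Finite :=
  (hprop.isCompact_preimage isCompact_singleton).finite <|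
    IsDiscrete.of_openPartialHomeomorph p subset_rfl fun e _ ↦ by
      obtain ⟨φ, hφ, h⟩ := hp e
      exact ⟨φ, hφ, h.symm⟩

theorem IsLocalHomeomorph.isCoveringMap_of_isProperMap {E B : Type*} [TopologicalSpace E]
    [TopologicalSpace B] [T2Space E] {p : E → B} (hp : IsLocalHomeomorph p)
    (hprop : IsProperMap p) : IsCoveringMap p :=
  isCoveringMap_iff_isCoveringMapOn_univ.mpr <|
    hprop.isClosedMap.isCoveringMapOn_of_isLocalHomeomorphOn
      (fun b _ ↦ hp.finite_fiber_of_isProperMap hprop b) hp.isLocalHomeomorphOn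

theorem IsLocalHomeomorph.surjective_of_isProperMap {E B : Type*} [TopologicalSpace E]
    [TopologicalSpace B] [Nonempty E] [PreconnectedSpace B] {p : E → B}
    (hp : IsLocalHomeomorph p) (hprop : IsProperMap p) : Function.Surjective p :=
  range_eq_univ.mp <| IsClopen.eq_univ
    ⟨hprop.isClosedMap.isClosed_range, hp.isOpenMap.isOpen_range⟩ (range_nonempty p)

theorem IsCoveringMap.isLocallyConstant_ncard_fiber {E B : Type*} [TopologicalSpace E]
    [TopologicalSpace B] {p : E → B} (hp : IsCoveringMap p) :
    IsLocallyConstant fun b ↦ (p ⁻¹' {b}).ncard := by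
  refine (IsLocallyConstant.iff_exists_open _).mpr fun b ↦ ?_
  obtain ⟨hI, V, hbV, h⟩ := hp b
  have key (z : B) (hz : z ∈ V) : (p ⁻¹' {z}).ncard = Nat.card (p ⁻¹' {b}) := by
    have hz : IsEvenlyCovered p z (p ⁻¹' {b}) := ⟨hI, V, hz, h⟩
    exact (Nat.card_congr hz.fiberHomeomorph.toEquiv).symm
  exact ⟨V, h.1, hbV, fun z hz ↦ (key z hz).trans (key b hbV).symm⟩

theorem image_val_preimage_mapsTo_restrict {X Y : Type*} {F : X → Y} {s : Set X} {t : Set Y}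
    (hm : MapsTo F s t) (K : Set t) :
    ((↑) : s → X) '' (hm.restrict F s t ⁻¹' K) = s ∩ F ⁻¹' (((↑) : t → Y) '' K) := by
  ext x
  constructor
  · rintro ⟨z, hz, rfl⟩
    exact ⟨z.2, _, hz, rfl⟩
  · rintro ⟨hx, z, hz, hzx⟩
    have hzx' : hm.restrict F s t ⟨x, hx⟩ = z := Subtype.ext hzx.symm
    exact ⟨⟨x, hx⟩, (congrArg (· ∈ K) hzx').mpr hz, rfl⟩

theorem statement1
    {X Y : Type*}
    [NormedAddCommGroup X] [NormedSpace ℝ X] [CompleteSpace X]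
    [NormedAddCommGroup Y] [NormedSpace ℝ Y] [CompleteSpace Y]
    (F : X → Y) (U : Set X) (hU : IsOpen U) (hF : ContinuousOn F U)
    (D : Set X) (hD : IsClosed D) (hDU : D ⊆ U)
    (hproper : ∀ K : Set Y, IsCompact K → IsCompact (D ∩ F ⁻¹' K))
    (T_D : Set X) (hT : IsDomainTile F U D T_D) :
    ∃ T_C : Set Y, IsImageTile F U D T_C ∧ F '' T_D = T_C ∧
      (∃ hm : Set.MapsTo F T_D T_C, IsCoveringMap (Set.MapsTo.restrict F T_D T_C hm)) ∧
      (∀ y ∈ T_C, (T_D ∩ F ⁻¹' {y}).Finite ∧ (T_D ∩ F ⁻¹' {y}).Nonempty) ∧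
      (∀ y₁ ∈ T_C, ∀ y₂ ∈ T_C,
        (T_D ∩ F ⁻¹' {y₁}).ncard = (T_D ∩ F ⁻¹' {y₂}).ncard) := by
  obtain ⟨x, hx, rfl⟩ := hT
  set S := criticalSet F U D ∪ frontier D with hS
  set W := (F '' S)ᶜ with hW
  set A := D \ flower F U D with hA
  have hFD : ContinuousOn F D := hF.mono hDU
  have hSD : S ⊆ D := union_subset (fun _ h ↦ h.1) hD.frontier_subset
  have hWo : IsOpen W := (isClosed_image_of_isCompact_inter_preimage hFD hproper
    ((isClosed_criticalSet F U hD).union isClosed_frontier) hSD).isOpen_compl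
  have hAeq : A = D ∩ F ⁻¹' W := by
    ext z
    simp only [hA, hW, hS, flower, mem_sdiff, mem_inter_iff, mem_preimage, mem_compl_iff]
    tauto
  have hAS : ∀ z ∈ A, z ∉ S := fun z hz hzS ↦ (hAeq ▸ hz).2 (mem_image_of_mem F hzS)
  have hAreg : ∀ z ∈ A, IsRegularAt F U z := fun z hz ↦ by
    by_contra h
    exact hAS z hz (.inl ⟨hz.1, h⟩)
  have hAint : A = interior D ∩ F ⁻¹' W := by
    refine subset_antisymm (fun z hz ↦ ?_) fun z hz ↦ ?_
    · refine ⟨?_, (hAeq ▸ hz).2⟩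
      by_contra h
      exact hAS z hz (.inr ⟨subset_closure hz.1, h⟩)
    · rw [hAeq]
      exact ⟨interior_subset hz.1, hz.2⟩
  have hAo : IsOpen A :=
    hAint ▸ (hFD.mono interior_subset).isOpen_inter_preimage isOpen_interior hWo
  set T := connectedComponentIn A x with hTdef
  have hTA : T ⊆ A := connectedComponentIn_subset A x
  have hxT : x ∈ T := mem_connectedComponentIn hx
  have hAW : MapsTo F A W := fun z hz ↦ (hAeq ▸ hz).2
  have hm : MapsTo F T (connectedComponentIn W (F x)) := mapsTo_iff_image_subset.mpr <|
    (isPreconnected_connectedComponentIn.image F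
      (hFD.mono (hTA.trans sdiff_subset))).subset_connectedComponentIn
      (mem_image_of_mem F hxT) ((hAW.mono_left hTA).image_subset)
  have hloc : IsLocalHomeomorph (hm.restrict F T _) :=
    (isLocalHomeomorphOn_of_isRegularAt fun z hz ↦ hAreg z (hTA hz))
      |>.isLocalHomeomorph_mapsTo_restrict hAo.connectedComponentIn hWo.connectedComponentIn hm
  have hprop : IsProperMap (hm.restrict F T _) := by
    refine isProperMap_iff_isCompact_preimage.mpr ⟨hloc.continuous, fun K hK ↦ ?_⟩
    rw [Subtype.isCompact_iff, image_val_preimage_mapsTo_restrict]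
    have hK' := hproper _ (hK.image continuous_subtype_val)
    convert hK'.inter_left (isClosed_closure (s := T)) using 1
    refine subset_antisymm (fun z hz ↦ ⟨subset_closure hz.1, (hTA hz.1).1, hz.2⟩) ?_
    rintro z ⟨hzT, hzD, hzK⟩
    have hzA : z ∈ A := by
      rw [hAeq]
      refine ⟨hzD, ?_⟩
      obtain ⟨w, -, hw⟩ := hzK
      rw [mem_preimage, ← hw]
      exact connectedComponentIn_subset _ _ w.2
    exact ⟨closure_connectedComponentIn_inter_subset A hx ⟨hzT, hzA⟩, hzK⟩
  have : Nonempty T := ⟨x, hxT⟩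
  have : PreconnectedSpace (connectedComponentIn W (F x)) :=
    isPreconnected_iff_preconnectedSpace.mp isPreconnected_connectedComponentIn
  have hcov := hloc.isCoveringMap_of_isProperMap hprop
  have hsurj := hloc.surjective_of_isProperMap hprop
  have hfiber (y : connectedComponentIn W (F x)) :
      T ∩ F ⁻¹' {(y : Y)} = (↑) '' (hm.restrict F T _ ⁻¹' {y}) := by
    rw [image_val_preimage_mapsTo_restrict, image_singleton]
  have hncard (y : connectedComponentIn W (F x)) :
      (T ∩ F ⁻¹' {(y : Y)}).ncard = (hm.restrict F T _ ⁻¹' {y}).ncard := by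
    rw [hfiber, ncard_image_of_injective _ Subtype.val_injective]
  refine ⟨connectedComponentIn W (F x), ⟨F x, hAW hx, rfl⟩, ?_, ⟨hm, hcov⟩, ?_, ?_⟩
  · refine subset_antisymm hm.image_subset fun y hy ↦ ?_
    obtain ⟨z, hz⟩ := hsurj ⟨y, hy⟩
    exact ⟨z, z.2, congrArg Subtype.val hz⟩
  · intro y hy
    rw [hfiber ⟨y, hy⟩]
    exact ⟨(hloc.finite_fiber_of_isProperMap hprop _).image _, Set.Nonempty.image _ (hsurj ⟨y, hy⟩)⟩
  · intro y₁ h₁ y₂ h₂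
    rw [hncard ⟨y₁, h₁⟩, hncard ⟨y₂, h₂⟩]
    exact hcov.isLocallyConstant_ncard_fiber.apply_eq_of_preconnectedSpace _ _
end

section
/- Assume the restriction F : D → Y is proper. Let y be a standard critical value and let T₁ and T₂ be two distinct image tiles whose closures both contain y. Then for every p₁ ∈ T₁ and p₂ ∈ T₂ the fibers D ∩ F⁻¹({p₁}) and D ∩ F⁻¹({p₂}) are finite and their cardinalities differ by exactly 2. -/
open Set Topology

/-- The data exhibiting `x ∈ U` as a fold of `F`: local changes of variables
(homeomorphisms) converting `F` into `(t, z) ↦ (t², z)` for a real Banach space `Z`. -/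
structure FoldData {X Y : Type*} [TopologicalSpace X] [TopologicalSpace Y]
    (F : X → Y) (U : Set X) (x : X) where
  Z : Type
  [instZ : NormedAddCommGroup Z]
  [instZ' : NormedSpace ℝ Z]
  [instZ'' : CompleteSpace Z]
  R₀ : Set ℝ
  Z₀ : Set Z
  openR₀ : IsOpen R₀
  memR₀ : (0 : ℝ) ∈ R₀
  openZ₀ : IsOpen Z₀
  memZ₀ : (0 : Z) ∈ Z₀
  V : Set X
  openV : IsOpen V
  memV : x ∈ V
  subV : V ⊆ U
  W : Set Y
  openW : IsOpen W
  subW : F '' V ⊆ W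
  W' : Set (ℝ × Z)
  openW' : IsOpen W'
  Φ : ↥(R₀ ×ˢ Z₀) ≃ₜ ↥V
  Ψ : ↥W ≃ₜ ↥W'
  hΦx : (Φ ⟨(0, 0), Set.mk_mem_prod memR₀ memZ₀⟩ : X) = x
  hconj : ∀ p : ↥(R₀ ×ˢ Z₀),
    (Ψ ⟨F (Φ p), subW ⟨(Φ p : X), (Φ p).2, rfl⟩⟩ : ℝ × Z) =
      ((p : ℝ × Z).1 ^ 2, (p : ℝ × Z).2)

/-- `x` is a fold of `F : U → Y`. -/
def IsFold {X Y : Type*} [TopologicalSpace X] [TopologicalSpace Y]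
    (F : X → Y) (U : Set X) (x : X) : Prop :=
  x ∈ U ∧ Nonempty (FoldData F U x)

/-- `y ∈ F(C)` is a standard critical value: all its preimages in `D` lie in the
interior of `D`, exactly one of them is a fold, and all the others are regular. -/
def IsStdCriticalValue {X Y : Type*} [TopologicalSpace X] [TopologicalSpace Y]
    (F : X → Y) (U D : Set X) (y : Y) : Prop :=
  y ∈ F '' criticalSet F U D ∧
  D ∩ F ⁻¹' {y} ⊆ interior D ∧
  ∃ x₀ ∈ D ∩ F ⁻¹' {y}, IsFold F U x₀ ∧
    (∀ x ∈ D ∩ F ⁻¹' {y}, IsFold F U x → x = x₀) ∧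
    (∀ x ∈ D ∩ F ⁻¹' {y}, x ≠ x₀ → IsRegularAt F U x)

theorem finite_fiber_of_isolated {X Y : Type*} [TopologicalSpace X] {F : X → Y} {D : Set X}
    {p : Y} (hK : IsCompact (D ∩ F ⁻¹' {p}))
    (h : ∀ x ∈ D ∩ F ⁻¹' {p}, ∃ V : Set X, IsOpen V ∧ x ∈ V ∧ V ∩ F ⁻¹' {p} ⊆ {x}) :
    (D ∩ F ⁻¹' {p}).Finite := by
  refine hK.induction_on finite_empty (fun s t hst ht => ht.subset hst)
    (fun s t hs ht => hs.union ht) fun x hx => ?_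
  obtain ⟨V, hV, hxV, hVx⟩ := h x hx
  exact ⟨_, inter_mem_nhdsWithin _ (hV.mem_nhds hxV),
    (finite_singleton x).subset fun z hz => hVx ⟨hz.2, hz.1.2⟩⟩

section LocalStructure

variable {X Y : Type*} [TopologicalSpace X] [TopologicalSpace Y]

/-- A homeomorphism between open subsets gives a partial homeomorphism of the ambient spaces. -/
theorem Homeomorph.exists_openPartialHomeomorph {V : Set X} {W : Set Y} (e : V ≃ₜ W)
    (hV : IsOpen V) (hW : IsOpen W) (hne : V.Nonempty) :
    ∃ f : OpenPartialHomeomorph X Y, f.source = V ∧ f.target = W ∧ ∀ v : V, f v = e v := by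
  have : Nonempty (⟨V, hV⟩ : TopologicalSpace.Opens X) := hne.to_subtype
  have : Nonempty (⟨W, hW⟩ : TopologicalSpace.Opens Y) := hne.to_subtype.map e
  let a := (⟨V, hV⟩ : TopologicalSpace.Opens X).openPartialHomeomorphSubtypeCoe inferInstance
  let b := (⟨W, hW⟩ : TopologicalSpace.Opens Y).openPartialHomeomorphSubtypeCoe inferInstance
  let e' : (⟨V, hV⟩ : TopologicalSpace.Opens X) ≃ₜ (⟨W, hW⟩ : TopologicalSpace.Opens Y) := e
  have ha (v : V) : a.symm v = v :=
    a.left_inv (x := v) (by simp [a])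
  refine ⟨(a.symm.trans e'.toOpenPartialHomeomorph).trans b, ?_, ?_, fun v => ?_⟩
  · simp [a, b]
  · simp [a, b]
  · change ((e' (a.symm v) : (⟨W, hW⟩ : TopologicalSpace.Opens Y)) : Y) = e v
    rw [ha]

theorem isRegularAt_iff {F : X → Y} {U : Set X} {x : X} :
    IsRegularAt F U x ↔ ∃ e : OpenPartialHomeomorph X Y,
      x ∈ e.source ∧ e.source ⊆ U ∧ EqOn F e e.source := by
  constructor
  · rintro ⟨V, hV, hx, hVU, hW, e, he⟩
    obtain ⟨f, rfl, -, hf⟩ := e.exists_openPartialHomeomorph hV hW ⟨x, hx⟩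
    exact ⟨f, hx, hVU, fun v hv => by rw [hf ⟨v, hv⟩, he ⟨v, hv⟩]⟩
  · rintro ⟨e, hx, hU, he⟩
    have himg : F '' e.source = e.target := by rw [he.image_eq, e.image_source_eq_target]
    refine ⟨e.source, e.open_source, hx, hU, himg ▸ e.open_target,
      e.toHomeomorphSourceTarget.trans (Homeomorph.setCongr himg.symm), fun v => ?_⟩
    exact (he v.2).symm

theorem IsRegularAt.exists_open_inter_fiber {F : X → Y} {U : Set X} {x : X}
    (hx : IsRegularAt F U x) : ∃ V : Set X, IsOpen V ∧ x ∈ V ∧ V ∩ F ⁻¹' {F x} ⊆ {x} := by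
  obtain ⟨e, hxe, -, he⟩ := isRegularAt_iff.1 hx
  refine ⟨e.source, e.open_source, hxe, fun z ⟨hze, hz⟩ => ?_⟩
  exact e.injOn hze hxe (by rw [← he hze, ← he hxe]; exact hz)

/-- Near the common value of a finite set `S` of regular points, every value is attained near `S`
exactly `S.ncard` times. -/
theorem exists_open_ncard_fiber_eq [T2Space X] {F : X → Y} {U : Set X} {y : Y} {S : Set X}
    (hS : S.Finite) :
    ∀ G : Set X, IsOpen G → S ⊆ G → (∀ x ∈ S, IsRegularAt F U x ∧ F x = y) →
      ∃ V : Set X, IsOpen V ∧ S ⊆ V ∧ V ⊆ G ∧ (∀ x ∈ V, IsRegularAt F U x) ∧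
        ∀ᶠ p in 𝓝 y, (V ∩ F ⁻¹' {p}).Finite ∧ (V ∩ F ⁻¹' {p}).ncard = S.ncard := by
  induction S, hS using Set.Finite.induction_on with
  | empty =>
    intro G _ _ _
    exact ⟨∅, isOpen_empty, subset_rfl, empty_subset _, by simp, by simp⟩
  | @insert a S haS hS ih =>
    intro G hG hSG hreg
    obtain ⟨A, B, hA, hB, haA, hSB, hAB⟩ :=
      SeparatedNhds.of_finite (finite_singleton a) hS (disjoint_singleton_left.2 haS)
    obtain ⟨V, hV, hSV, hVG, hVreg, hVcard⟩ := ih (G ∩ B) (hG.inter hB)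
      (subset_inter ((subset_insert _ _).trans hSG) hSB)
      (fun x hx => hreg x (mem_insert_of_mem _ hx))
    obtain ⟨ha, hay⟩ := hreg a (mem_insert _ _)
    obtain ⟨e, hae, heU, he⟩ := isRegularAt_iff.1 ha
    have hVa : IsOpen (e.source ∩ (G ∩ A)) := e.open_source.inter (hG.inter hA)
    have haV : a ∈ e.source ∩ (G ∩ A) := ⟨hae, hSG (mem_insert _ _), haA rfl⟩
    have hdisj : Disjoint (e.source ∩ (G ∩ A)) V :=
      hAB.mono (fun x hx => hx.2.2) (fun x hx => (hVG hx).2)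
    refine ⟨(e.source ∩ (G ∩ A)) ∪ V, hVa.union hV, ?_, ?_, ?_, ?_⟩
    · exact insert_subset (Or.inl haV) (hSV.trans subset_union_right)
    · exact union_subset (fun x hx => hx.2.1) (fun x hx => (hVG hx).1)
    · rintro x (hx | hx)
      · exact isRegularAt_iff.2 ⟨e, hx.1, heU, he⟩
      · exact hVreg x hx
    · have himg : e '' (e.source ∩ (G ∩ A)) ∈ 𝓝 y := by
        rw [← hay, he hae]
        exact (e.isOpen_image_of_subset_source hVa inter_subset_left).mem_nhds
          (mem_image_of_mem _ haV)
      filter_upwards [hVcard, himg] with p ⟨hfin, hcard⟩ ⟨q, hq, hqp⟩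
      have hone : (e.source ∩ (G ∩ A)) ∩ F ⁻¹' {p} = {q} := by
        ext x
        constructor
        · rintro ⟨hx, hxp⟩
          exact e.injOn hx.1 hq.1 (by rw [← he hx.1, hqp]; exact hxp)
        · rintro rfl
          exact ⟨hq, by rw [mem_preimage, he hq.1, hqp]; rfl⟩
      rw [union_inter_distrib_right, hone]
      refine ⟨(finite_singleton q).union hfin, ?_⟩
      rw [ncard_union_eq _ (finite_singleton q) hfin, ncard_singleton, hcard,
        ncard_insert_of_notMem haS hS, add_comm]
      exact disjoint_singleton_left.2 fun h => hdisj.le_bot ⟨hq, h.1⟩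

/-- A properly restricted continuous map has upper semicontinuous fibers. -/
theorem eventually_fiber_subset [T2Space Y] [CompactlyCoherentSpace Y]
    {F : X → Y} {D V : Set X} (hF : ContinuousOn F D)
    (hproper : ∀ K : Set Y, IsCompact K → IsCompact (D ∩ F ⁻¹' K)) (hV : IsOpen V) {y : Y}
    (hy : D ∩ F ⁻¹' {y} ⊆ V) : ∀ᶠ p in 𝓝 y, D ∩ F ⁻¹' {p} ⊆ V := by
  have hp : IsProperMap (fun x : D => F x) := by
    refine isProperMap_iff_isCompact_preimage.2
      ⟨continuousOn_iff_continuous_domRestrict.1 hF, fun {K} hK => ?_⟩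
    rw [Subtype.isCompact_iff]
    convert hproper K hK using 1
    ext x
    simp [and_comm]
  have hcl : IsClosed ((fun x : D => F x) '' ((↑) ⁻¹' Vᶜ)) :=
    hp.isClosedMap _ (hV.isClosed_compl.preimage continuous_subtype_val)
  have hmem : y ∉ (fun x : D => F x) '' ((↑) ⁻¹' Vᶜ) := by
    rintro ⟨x, hx, hxy⟩
    exact hx (hy ⟨x.2, hxy⟩)
  filter_upwards [hcl.isOpen_compl.mem_nhds hmem] with p hp x ⟨hxD, hxp⟩
  by_contra hxV
  exact hp ⟨⟨x, hxD⟩, hxV, hxp⟩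

/-- Over a value all of whose preimages in `D` are regular interior points, the number of
preimages in `D` is finite and locally constant. -/
theorem eventually_ncard_fiber_eq [T2Space X] [T2Space Y] [CompactlyCoherentSpace Y]
    {F : X → Y} {U D : Set X} (hF : ContinuousOn F D)
    (hproper : ∀ K : Set Y, IsCompact K → IsCompact (D ∩ F ⁻¹' K)) {p : Y}
    (hp : ∀ x ∈ D ∩ F ⁻¹' {p}, x ∈ interior D ∧ IsRegularAt F U x) :
    (D ∩ F ⁻¹' {p}).Finite ∧
      ∀ᶠ q in 𝓝 p, (D ∩ F ⁻¹' {q}).ncard = (D ∩ F ⁻¹' {p}).ncard := by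
  have hfin : (D ∩ F ⁻¹' {p}).Finite := by
    refine finite_fiber_of_isolated (hproper {p} isCompact_singleton) fun x hx => ?_
    exact hx.2 ▸ (hp x hx).2.exists_open_inter_fiber
  obtain ⟨V, hV, hSV, hVD, -, hcard⟩ := exists_open_ncard_fiber_eq (F := F) (U := U) (y := p) hfin
    (interior D) isOpen_interior (fun x hx => (hp x hx).1) (fun x hx => ⟨(hp x hx).2, hx.2⟩)
  refine ⟨hfin, ?_⟩
  filter_upwards [hcard, eventually_fiber_subset hF hproper hV hSV] with q hq hqV
  rw [← hq.2]
  congr 1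
  exact Subset.antisymm (fun x hx => ⟨hqV hx, hx.2⟩)
    (fun x hx => ⟨interior_subset (hVD hx.1), hx.2⟩)

/-- Squaring, as a partial homeomorphism from the half-line `{t | 0 < c * t}`, `c = ±1`,
onto the positive half-line. -/
noncomputable def sqOpenPartialHomeomorph (c : ℝ) (hc : c * c = 1) : OpenPartialHomeomorph ℝ ℝ where
  toFun t := t ^ 2
  invFun s := c * √s
  source := {t | 0 < c * t}
  target := {s | 0 < s}
  map_source' t ht := by
    have : t ≠ 0 := by rintro rfl; simp at ht
    simp only [mem_ofPred_eq]
    positivity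
  map_target' s hs := by
    have := Real.sqrt_pos.2 hs
    simpa [← mul_assoc, hc] using this
  left_inv' t ht := by
    have : t ^ 2 = (c * t) ^ 2 := by linear_combination (-t ^ 2) * hc
    rw [this, Real.sqrt_sq (le_of_lt ht), ← mul_assoc, hc, one_mul]
  right_inv' s hs := by
    rw [mul_pow, Real.sq_sqrt (le_of_lt hs)]
    linear_combination s * hc
  open_source := isOpen_lt continuous_const (by fun_prop)
  open_target := isOpen_lt continuous_const continuous_id
  continuousOn_toFun := by fun_prop
  continuousOn_invFun := by fun_prop

/-- The coordinate charts `φ`, `ψ` bring `F` into the fold normal form `(t, z) ↦ (t ^ 2, z)`. -/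
def IsFoldChart {Z : Type*} [TopologicalSpace Z] (F : X → Y)
    (φ : OpenPartialHomeomorph X (ℝ × Z)) (ψ : OpenPartialHomeomorph Y (ℝ × Z)) : Prop :=
  ∀ q ∈ φ.source, F q ∈ ψ.source ∧ ψ (F q) = ((φ q).1 ^ 2, (φ q).2)

theorem IsFoldChart.isRegularAt {Z : Type*} [TopologicalSpace Z] {F : X → Y} {U : Set X}
    {φ : OpenPartialHomeomorph X (ℝ × Z)} {ψ : OpenPartialHomeomorph Y (ℝ × Z)}
    (h : IsFoldChart F φ ψ) (hU : φ.source ⊆ U) {x : X} (hx : x ∈ φ.source)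
    (hx0 : (φ x).1 ≠ 0) : IsRegularAt F U x := by
  obtain ⟨c, hc, hpos⟩ : ∃ c : ℝ, c * c = 1 ∧ 0 < c * (φ x).1 := by
    rcases lt_or_gt_of_ne hx0 with h | h
    · exact ⟨-1, by norm_num, by linarith⟩
    · exact ⟨1, by norm_num, by linarith⟩
  refine isRegularAt_iff.2 ⟨(φ.trans ((sqOpenPartialHomeomorph c hc).prod
    (OpenPartialHomeomorph.refl Z))).trans ψ.symm, ?_, ?_, ?_⟩
  · have := ψ.map_source (h x hx).1
    rw [(h x hx).2] at this
    simpa [hx] using ⟨hpos, this⟩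
  · intro q hq
    simp at hq
    exact hU hq.1.1
  · intro q hq
    simp at hq
    have := ψ.left_inv (h q hq.1.1).1
    rw [(h q hq.1.1).2] at this
    exact this.symm

theorem IsFoldChart.not_isRegularAt {Z : Type*} [TopologicalSpace Z] {F : X → Y} {U : Set X}
    {φ : OpenPartialHomeomorph X (ℝ × Z)} {ψ : OpenPartialHomeomorph Y (ℝ × Z)}
    (h : IsFoldChart F φ ψ) {z : Z} (hz : ((0 : ℝ), z) ∈ φ.target) :
    ¬ IsRegularAt F U (φ.symm (0, z)) := by
  intro hreg
  obtain ⟨e, hxe, -, he⟩ := isRegularAt_iff.1 hreg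
  have hnhds : φ.target ∩ φ.symm ⁻¹' e.source ∈ 𝓝 ((0 : ℝ), z) :=
    Filter.inter_mem (φ.open_target.mem_nhds hz)
      ((φ.continuousAt_symm hz).preimage_mem_nhds (e.open_source.mem_nhds hxe))
  have h1 : Filter.Tendsto (fun t : ℝ => (t, z)) (𝓝 0) (𝓝 (0, z)) :=
    Continuous.tendsto (by fun_prop) 0
  have h2 : Filter.Tendsto (fun t : ℝ => (-t, z)) (𝓝 0) (𝓝 (0, z)) :=
    Continuous.tendsto' (by fun_prop) _ _ (by simp)
  have hev : ∀ᶠ t in 𝓝[>] (0 : ℝ), 0 < t ∧ (t, z) ∈ φ.target ∩ φ.symm ⁻¹' e.source ∧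
      (-t, z) ∈ φ.target ∩ φ.symm ⁻¹' e.source :=
    (eventually_mem_nhdsWithin.and
      (((h1.eventually hnhds).and (h2.eventually hnhds)).filter_mono nhdsWithin_le_nhds))
  obtain ⟨t, ht, ⟨ht1, hte1⟩, ⟨ht2, hte2⟩⟩ := hev.exists
  have hF : F (φ.symm (t, z)) = F (φ.symm (-t, z)) := by
    have a := h _ (φ.map_target ht1)
    have b := h _ (φ.map_target ht2)
    rw [φ.right_inv ht1] at a
    rw [φ.right_inv ht2] at b
    exact ψ.injOn a.1 b.1 (by rw [a.2, b.2]; simp)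
  have := φ.symm.injOn ht1 ht2 (e.injOn hte1 hte2 (by rw [← he hte1, ← he hte2, hF]))
  simp at this
  linarith

/-- Local picture at a fold: a neighborhood of the fold value splits into a connected side with
exactly two preimages near the fold, both regular, a connected side with none, and a wall made of
critical values. -/
theorem IsFold.exists_local_sides {F : X → Y} {U : Set X} {x : X} (hx : IsFold F U x)
    {G : Set X} (hG : IsOpen G) (hxG : x ∈ G) :
    ∃ V : Set X, IsOpen V ∧ x ∈ V ∧ V ⊆ G ∧ V ∩ F ⁻¹' {F x} ⊆ {x} ∧ ∀ P ∈ 𝓝 (F x), ∃ A B C : Set Y,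
      A ∪ B ∪ C ∈ 𝓝 (F x) ∧ A ∪ B ∪ C ⊆ P ∧ IsPreconnected A ∧ IsPreconnected B ∧
      (∀ p ∈ A, (V ∩ F ⁻¹' {p}).ncard = 2 ∧ ∀ q ∈ V ∩ F ⁻¹' {p}, IsRegularAt F U q) ∧
      (∀ p ∈ B, V ∩ F ⁻¹' {p} = ∅) ∧
      (∀ p ∈ C, ∃ q ∈ V ∩ F ⁻¹' {p}, ¬ IsRegularAt F U q) := by
  obtain ⟨-, ⟨d⟩⟩ := hx
  obtain ⟨Z, R₀, Z₀, hR, hR0, hZ, hZ0, V₀, hV₀, hxV₀, hV₀U, W, hW, hsub, W', hW', Φ, Ψ, hΦx,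
    hconj⟩ := d
  obtain ⟨φ, hφs, hφt, hφ⟩ := Φ.symm.exists_openPartialHomeomorph hV₀ (hR.prod hZ) ⟨x, hxV₀⟩
  obtain ⟨ψ, hψs, hψt, hψ⟩ := Ψ.exists_openPartialHomeomorph hW hW' ⟨F x, hsub ⟨x, hxV₀, rfl⟩⟩
  have hfold : IsFoldChart F φ ψ := by
    intro q hq
    rw [hφs] at hq
    have hFq : F q ∈ W := hsub ⟨q, hq, rfl⟩
    refine ⟨hψs ▸ hFq, ?_⟩
    have := hconj (Φ.symm ⟨q, hq⟩)
    simp only [Homeomorph.apply_symm_apply] at this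
    rw [hφ ⟨q, hq⟩, hψ ⟨F q, hFq⟩, this]
  have hxs : x ∈ φ.source := hφs ▸ hxV₀
  have hφx : φ x = 0 := by
    have : (⟨x, hxV₀⟩ : V₀) = Φ ⟨(0, 0), mk_mem_prod hR0 hZ0⟩ := Subtype.ext hΦx.symm
    rw [hφ ⟨x, hxV₀⟩, this, Homeomorph.symm_apply_apply]
    rfl
  have hψx : ψ (F x) = 0 := by rw [(hfold x hxs).2, hφx]; simp
  have hFx : F x ∈ ψ.source := (hfold x hxs).1
  have hx0 : φ.symm 0 = x := by rw [← hφx, φ.left_inv hxs]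
  have hy0 : ψ.symm 0 = F x := by rw [← hψx, ψ.left_inv hFx]
  have hφ0 : (0 : ℝ × Z) ∈ φ.target := hφx ▸ φ.map_source hxs
  have hψ0 : (0 : ℝ × Z) ∈ ψ.target := hψx ▸ ψ.map_source hFx
  obtain ⟨δ, hδ, hδb⟩ := Metric.mem_nhds_iff.1 (Filter.inter_mem (φ.open_target.mem_nhds hφ0)
    ((φ.continuousAt_symm hφ0).preimage_mem_nhds (hG.mem_nhds (by rwa [hx0]))))
  refine ⟨φ.source ∩ φ ⁻¹' Metric.ball 0 δ, φ.isOpen_inter_preimage Metric.isOpen_ball,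
    ⟨hxs, by simp [hφx, hδ]⟩, ?_, ?_, fun P hP => ?_⟩
  · rintro q ⟨hq, hqb⟩
    have := (hδb hqb).2
    rwa [mem_preimage, φ.left_inv hq] at this
  · rintro q ⟨⟨hq, -⟩, hqF⟩
    have h := (hfold q hq).2
    rw [show F q = F x from hqF, hψx] at h
    refine φ.injOn hq hxs ?_
    rw [hφx]
    exact Prod.ext (pow_eq_zero_iff two_ne_zero |>.1 (congrArg Prod.fst h).symm)
      (congrArg Prod.snd h).symm
  obtain ⟨ε₀, hε₀, hε₀b⟩ := Metric.mem_nhds_iff.1 (Filter.inter_mem (ψ.open_target.mem_nhds hψ0)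
    ((ψ.continuousAt_symm hψ0).preimage_mem_nhds (by rwa [hy0])))
  obtain ⟨ε, hε, hεε₀, hεδ, hεδ2⟩ : ∃ ε > 0, ε ≤ ε₀ ∧ ε ≤ δ ∧ ε ≤ δ ^ 2 :=
    ⟨min ε₀ (min δ (δ ^ 2)), by positivity, min_le_left _ _,
      (min_le_right _ _).trans (min_le_left _ _), (min_le_right _ _).trans (min_le_right _ _)⟩
  have hmem : ∀ {r : ℝ} {s : ℝ} {z : Z}, (s, z) ∈ Metric.ball (0 : ℝ × Z) r ↔
      |s| < r ∧ ‖z‖ < r := by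
    intro r s z
    simp [Prod.norm_mk]
  have hψb : ∀ {s z}, |s| < ε → z ∈ Metric.ball (0 : Z) ε →
      (s, z) ∈ ψ.target ∧ ψ.symm (s, z) ∈ P := fun {s z} hs hz =>
    hε₀b (hmem.2 ⟨hs.trans_le hεε₀, (mem_ball_zero_iff.1 hz).trans_le hεε₀⟩)
  have hconn : ∀ I : Set ℝ, Convex ℝ I → I ⊆ Ioo (-ε) ε →
      IsPreconnected (ψ.symm '' (I ×ˢ Metric.ball (0 : Z) ε)) := by
    intro I hI hIε
    refine (hI.prod (convex_ball _ _)).isPreconnected.image _ (ψ.continuousOn_symm.mono ?_)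
    rintro ⟨s, z⟩ ⟨hs, hz⟩
    exact (hψb (abs_lt.2 (hIε hs)) hz).1
  have hfib : ∀ {s z}, |s| < ε → z ∈ Metric.ball (0 : Z) ε → ∀ q,
      q ∈ (φ.source ∩ φ ⁻¹' Metric.ball 0 δ) ∩ F ⁻¹' {ψ.symm (s, z)} ↔
        ∃ t, t ^ 2 = s ∧ (t, z) ∈ φ.target ∧ q = φ.symm (t, z) := by
    intro s z hs hz q
    constructor
    · rintro ⟨⟨hq, hqb⟩, hqF⟩
      have h := (hfold q hq).2
      rw [show F q = ψ.symm (s, z) from hqF, ψ.right_inv (hψb hs hz).1, Prod.mk.injEq] at h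
      refine ⟨(φ q).1, h.1.symm, ?_, ?_⟩
      · rw [h.2]; exact φ.map_source hq
      · rw [h.2]; exact (φ.left_inv hq).symm
    · rintro ⟨t, rfl, ht, rfl⟩
      refine ⟨⟨φ.map_target ht, ?_⟩, ?_⟩
      · rw [mem_preimage, φ.right_inv ht]
        refine hmem.2 ⟨?_, (mem_ball_zero_iff.1 hz).trans_le hεδ⟩
        refine abs_lt_of_sq_lt_sq ?_ hδ.le
        exact (le_abs_self _).trans_lt (hs.trans_le hεδ2)
      · have h := hfold _ (φ.map_target ht)
        rw [φ.right_inv ht] at h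
        rw [mem_preimage, mem_singleton_iff, ← h.2, ψ.left_inv h.1]
  have htarget : ∀ {t z}, |t ^ 2| < ε → z ∈ Metric.ball (0 : Z) ε → (t, z) ∈ φ.target := by
    intro t z ht hz
    refine (hδb (hmem.2 ⟨?_, (mem_ball_zero_iff.1 hz).trans_le hεδ⟩)).1
    exact abs_lt_of_sq_lt_sq ((le_abs_self _).trans_lt (ht.trans_le hεδ2)) hδ.le
  refine ⟨ψ.symm '' (Ioo 0 ε ×ˢ Metric.ball 0 ε), ψ.symm '' (Ioo (-ε) 0 ×ˢ Metric.ball 0 ε),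
    ψ.symm '' ({0} ×ˢ Metric.ball 0 ε), ?_, ?_, hconn _ (convex_Ioo _ _) ?_,
    hconn _ (convex_Ioo _ _) ?_, ?_, ?_, ?_⟩
  · have hb : ψ.symm '' Metric.ball 0 ε ∈ 𝓝 (F x) := by
      rw [← hy0]
      exact ψ.symm.image_mem_nhds hψ0 (Metric.ball_mem_nhds _ hε)
    refine Filter.mem_of_superset hb ?_
    rw [← image_union, ← image_union]
    refine image_mono ?_
    rintro ⟨s, z⟩ hsz
    obtain ⟨hs, hz⟩ := hmem.1 hsz
    rw [abs_lt] at hs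
    rw [← mem_ball_zero_iff] at hz
    rcases lt_trichotomy s 0 with h | h | h
    · exact Or.inl (Or.inr ⟨⟨hs.1, h⟩, hz⟩)
    · exact Or.inr ⟨h, hz⟩
    · exact Or.inl (Or.inl ⟨⟨h, hs.2⟩, hz⟩)
  · rintro p ((⟨⟨s, z⟩, ⟨hs, hz⟩, rfl⟩ | ⟨⟨s, z⟩, ⟨hs, hz⟩, rfl⟩) | ⟨⟨s, z⟩, ⟨hs, hz⟩, rfl⟩)
    · exact (hψb (abs_lt.2 ⟨by linarith [hs.1], hs.2⟩) hz).2
    · exact (hψb (abs_lt.2 ⟨hs.1, by linarith [hs.2]⟩) hz).2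
    · rw [show s = 0 from hs]
      exact (hψb (by simpa using hε) hz).2
  · exact Ioo_subset_Ioo_left (by linarith)
  · exact Ioo_subset_Ioo_right (by linarith)
  · rintro p ⟨⟨s, z⟩, ⟨hs, hz⟩, rfl⟩
    replace hs : 0 < s ∧ s < ε := hs
    have hsε : |s| < ε := abs_lt.2 ⟨by linarith [hs.1], hs.2⟩
    have hsq : √s ^ 2 = s := Real.sq_sqrt hs.1.le
    have hpos : 0 < √s := Real.sqrt_pos.2 hs.1
    have ht1 : (√s, z) ∈ φ.target := htarget (by rwa [hsq]) hz
    have ht2 : (-√s, z) ∈ φ.target := htarget (by rwa [neg_sq, hsq]) hz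
    constructor
    · rw [ncard_eq_two]
      refine ⟨φ.symm (√s, z), φ.symm (-√s, z), fun h => ?_, ?_⟩
      · have := φ.symm.injOn ht1 ht2 h
        simp only [Prod.mk.injEq, and_true] at this
        linarith
      · ext q
        rw [hfib hsε hz]
        constructor
        · rintro ⟨t, ht, -, rfl⟩
          rcases sq_eq_sq_iff_eq_or_eq_neg.1 (ht.trans hsq.symm) with rfl | rfl
          · exact Or.inl rfl
          · exact Or.inr rfl
        · rintro (rfl | rfl)
          · exact ⟨_, hsq, ht1, rfl⟩
          · exact ⟨_, by rw [neg_sq, hsq], ht2, rfl⟩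
    · intro q hq
      obtain ⟨t, ht, htt, rfl⟩ := (hfib hsε hz q).1 hq
      refine hfold.isRegularAt (hφs ▸ hV₀U) hq.1.1 ?_
      rw [φ.right_inv htt]
      rintro rfl
      simp at ht
      linarith [hs.1]
  · rintro p ⟨⟨s, z⟩, ⟨hs, hz⟩, rfl⟩
    replace hs : -ε < s ∧ s < 0 := hs
    refine eq_empty_of_forall_notMem fun q hq => ?_
    obtain ⟨t, ht, -⟩ := (hfib (abs_lt.2 ⟨hs.1, by linarith⟩) hz q).1 hq
    nlinarith [sq_nonneg t]
  · rintro p ⟨⟨s, z⟩, ⟨hs, hz⟩, rfl⟩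
    obtain rfl : s = 0 := hs
    have ht : ((0 : ℝ), z) ∈ φ.target := htarget (by simpa using hε) hz
    exact ⟨_, (hfib (by simpa using hε) hz _).2 ⟨0, by simp, ht, rfl⟩, hfold.not_isRegularAt ht⟩

end LocalStructure

section Tiles

variable {X Y : Type*} [TopologicalSpace X] [TopologicalSpace Y] {F : X → Y} {U D : Set X}

theorem mem_compl_image_criticalSet_union_frontier_iff (hD : IsClosed D) {p : Y} :
    p ∈ (F '' (criticalSet F U D ∪ frontier D))ᶜ ↔
      ∀ x ∈ D ∩ F ⁻¹' {p}, x ∈ interior D ∧ IsRegularAt F U x := by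
  constructor
  · rintro hp x ⟨hxD, hxp⟩
    constructor
    · by_contra h
      exact hp ⟨x, Or.inr (by rw [hD.frontier_eq]; exact ⟨hxD, h⟩), hxp⟩
    · by_contra h
      exact hp ⟨x, Or.inl ⟨hxD, h⟩, hxp⟩
  · rintro h ⟨x, hx | hx, rfl⟩
    · exact hx.2 (h x ⟨hx.1, rfl⟩).2
    · rw [hD.frontier_eq] at hx
      exact hx.2 (h x ⟨hx.1, rfl⟩).1

theorem IsImageTile.subset {T : Set Y} (hT : IsImageTile F U D T) :
    T ⊆ (F '' (criticalSet F U D ∪ frontier D))ᶜ := by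
  obtain ⟨y, -, rfl⟩ := hT
  exact connectedComponentIn_subset _ _

theorem IsImageTile.isPreconnected {T : Set Y} (hT : IsImageTile F U D T) :
    IsPreconnected T := by
  obtain ⟨y, -, rfl⟩ := hT
  exact isPreconnected_connectedComponentIn

theorem IsImageTile.eq_of_isPreconnected {T₁ T₂ A : Set Y} (hT₁ : IsImageTile F U D T₁)
    (hT₂ : IsImageTile F U D T₂) (hA : IsPreconnected A)
    (hAB : A ⊆ (F '' (criticalSet F U D ∪ frontier D))ᶜ) {q₁ q₂ : Y}
    (h₁ : q₁ ∈ T₁ ∩ A) (h₂ : q₂ ∈ T₂ ∩ A) : T₁ = T₂ := by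
  obtain ⟨y₁, -, rfl⟩ := hT₁
  obtain ⟨y₂, -, rfl⟩ := hT₂
  rw [connectedComponentIn_eq h₁.1, connectedComponentIn_eq h₂.1]
  exact connectedComponentIn_eq (hA.subset_connectedComponentIn h₁.2 hAB h₂.2)

theorem IsImageTile.ncard_fiber_eq [T2Space X] [T2Space Y] [CompactlyCoherentSpace Y]
    (hF : ContinuousOn F D) (hD : IsClosed D)
    (hproper : ∀ K : Set Y, IsCompact K → IsCompact (D ∩ F ⁻¹' K)) {T : Set Y}
    (hT : IsImageTile F U D T) {p q : Y} (hp : p ∈ T) (hq : q ∈ T) :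
    (D ∩ F ⁻¹' {p}).ncard = (D ∩ F ⁻¹' {q}).ncard := by
  refine hT.isPreconnected.constant (f := fun p => (D ∩ F ⁻¹' {p}).ncard) (fun r hr => ?_) hp hq
  refine ContinuousAt.continuousWithinAt (Filter.Tendsto.mono_right ?_ (pure_le_nhds _))
  rw [Filter.tendsto_pure]
  exact (eventually_ncard_fiber_eq hF hproper
    ((mem_compl_image_criticalSet_union_frontier_iff hD).1 (hT.subset hr))).2

end Tiles

/-- Near a standard critical value, the complement of `F(C ∪ ∂D)` consists of two connected
sides whose fibers have `n + 2` and `n` elements. -/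
theorem IsStdCriticalValue.exists_sides {X Y : Type*} [TopologicalSpace X] [TopologicalSpace Y]
    [T2Space X] [T2Space Y] [CompactlyCoherentSpace Y] {F : X → Y} {U D : Set X}
    (hF : ContinuousOn F D) (hD : IsClosed D)
    (hproper : ∀ K : Set Y, IsCompact K → IsCompact (D ∩ F ⁻¹' K)) {y : Y}
    (hy : IsStdCriticalValue F U D y) :
    ∃ (n : ℕ) (A B : Set Y), IsPreconnected A ∧ IsPreconnected B ∧
      A ⊆ (F '' (criticalSet F U D ∪ frontier D))ᶜ ∧
      B ⊆ (F '' (criticalSet F U D ∪ frontier D))ᶜ ∧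
      (A ∪ B ∪ F '' (criticalSet F U D ∪ frontier D)) ∈ 𝓝 y ∧
      (∀ p ∈ A, (D ∩ F ⁻¹' {p}).ncard = n + 2) ∧ (∀ p ∈ B, (D ∩ F ⁻¹' {p}).ncard = n) := by
  obtain ⟨-, hint, x₀, ⟨hx₀D, rfl⟩, hfold, -, hreg⟩ := hy
  have hx₀int : x₀ ∈ interior D := hint ⟨hx₀D, rfl⟩
  have hfin : (D ∩ F ⁻¹' {F x₀}).Finite := by
    refine finite_fiber_of_isolated (hproper _ isCompact_singleton) fun x hx => ?_
    rw [← show F x = F x₀ from hx.2]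
    by_cases h : x = x₀
    · subst h
      obtain ⟨V, hV, hxV, -, hVx, -⟩ := hfold.exists_local_sides isOpen_univ (mem_univ x)
      exact ⟨V, hV, hxV, hVx⟩
    · exact (hreg x hx h).exists_open_inter_fiber
  have hS : ((D ∩ F ⁻¹' {F x₀}) \ {x₀}).Finite := hfin.sdiff
  obtain ⟨G₀, G₁, hG₀, hG₁, hxG₀, hSG₁, hG⟩ :=
    SeparatedNhds.of_finite (finite_singleton x₀) hS disjoint_sdiff_right
  obtain ⟨V₁, hV₁, hSV₁, hV₁G, hV₁reg, hV₁card⟩ :=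
    exists_open_ncard_fiber_eq (F := F) (U := U) (y := F x₀) hS
      (interior D ∩ G₁) (isOpen_interior.inter hG₁)
      (subset_inter (sdiff_subset.trans hint) hSG₁)
      (fun x hx => ⟨hreg x hx.1 hx.2, hx.1.2⟩)
  obtain ⟨V₀, hV₀, hxV₀, hV₀G, -, hsides⟩ :=
    hfold.exists_local_sides (isOpen_interior.inter hG₀) ⟨hx₀int, hxG₀ rfl⟩
  have hsub : D ∩ F ⁻¹' {F x₀} ⊆ V₀ ∪ V₁ := by
    intro x hx
    by_cases h : x = x₀
    · exact Or.inl (h ▸ hxV₀)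
    · exact Or.inr (hSV₁ ⟨hx, h⟩)
  obtain ⟨A, B, C, hnhds, hP, hA, hB, hAf, hBf, hCf⟩ := hsides _
    (hV₁card.and (eventually_fiber_subset hF hproper (hV₀.union hV₁) hsub))
  have hsplit : ∀ p ∈ A ∪ B ∪ C,
      D ∩ F ⁻¹' {p} = (V₀ ∩ F ⁻¹' {p}) ∪ (V₁ ∩ F ⁻¹' {p}) := by
    intro p hp
    rw [← union_inter_distrib_right]
    refine Subset.antisymm (fun x hx => ⟨(hP hp).2 hx, hx.2⟩) ?_
    rintro x ⟨hx | hx, hxp⟩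
    · exact ⟨interior_subset (hV₀G hx).1, hxp⟩
    · exact ⟨interior_subset (hV₁G hx).1, hxp⟩
  have hdisj : Disjoint V₀ V₁ := hG.mono (fun x hx => (hV₀G hx).2) (fun x hx => (hV₁G hx).2)
  have hcompl : ∀ p ∈ A ∪ B ∪ C, (∀ q ∈ V₀ ∩ F ⁻¹' {p}, IsRegularAt F U q) →
      p ∈ (F '' (criticalSet F U D ∪ frontier D))ᶜ := by
    intro p hp h
    rw [mem_compl_image_criticalSet_union_frontier_iff hD, hsplit p hp]
    rintro x (hx | hx)
    · exact ⟨(hV₀G hx.1).1, h x hx⟩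
    · exact ⟨(hV₁G hx.1).1, hV₁reg x hx.1⟩
  refine ⟨((D ∩ F ⁻¹' {F x₀}) \ {x₀}).ncard, A, B, hA, hB, fun p hp => ?_, fun p hp => ?_, ?_,
    fun p hp => ?_, fun p hp => ?_⟩
  · exact hcompl p (Or.inl (Or.inl hp)) (hAf p hp).2
  · exact hcompl p (Or.inl (Or.inr hp)) (by simp [hBf p hp])
  · refine Filter.mem_of_superset hnhds (union_subset_union_right _ fun p hp => ?_)
    obtain ⟨q, ⟨hq, hqp⟩, hqr⟩ := hCf p hp
    exact ⟨q, Or.inl ⟨interior_subset (hV₀G hq).1, hqr⟩, hqp⟩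
  · have hpP := hP (Or.inl (Or.inl hp))
    have h2 := (hAf p hp).1
    rw [hsplit p (Or.inl (Or.inl hp)), ncard_union_eq
      (hdisj.mono inter_subset_left inter_subset_left)
      (finite_of_ncard_ne_zero (by omega)) hpP.1.1, h2, hpP.1.2, add_comm]
  · have hpP := hP (Or.inl (Or.inr hp))
    rw [hsplit p (Or.inl (Or.inr hp)), hBf p hp, empty_union, hpP.1.2]

theorem statement4
    {X Y : Type*}
    [NormedAddCommGroup X] [NormedSpace ℝ X] [CompleteSpace X]
    [NormedAddCommGroup Y] [NormedSpace ℝ Y] [CompleteSpace Y]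
    (F : X → Y) (U : Set X) (hU : IsOpen U) (hF : ContinuousOn F U)
    (D : Set X) (hD : IsClosed D) (hDU : D ⊆ U)
    (hproper : ∀ K : Set Y, IsCompact K → IsCompact (D ∩ F ⁻¹' K))
    (y : Y) (hy : IsStdCriticalValue F U D y)
    (T₁ T₂ : Set Y) (hT₁ : IsImageTile F U D T₁) (hT₂ : IsImageTile F U D T₂)
    (hne : T₁ ≠ T₂) (hy₁ : y ∈ closure T₁) (hy₂ : y ∈ closure T₂) :
    ∀ p₁ ∈ T₁, ∀ p₂ ∈ T₂,
      (D ∩ F ⁻¹' {p₁}).Finite ∧ (D ∩ F ⁻¹' {p₂}).Finite ∧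
      ((D ∩ F ⁻¹' {p₁}).ncard = (D ∩ F ⁻¹' {p₂}).ncard + 2 ∨
       (D ∩ F ⁻¹' {p₂}).ncard = (D ∩ F ⁻¹' {p₁}).ncard + 2) := by
  have hFD := hF.mono hDU
  obtain ⟨n, A, B, hA, hB, hAc, hBc, hnhds, hAn, hBn⟩ := hy.exists_sides hFD hD hproper
  have hfin : ∀ T, IsImageTile F U D T → ∀ p ∈ T, (D ∩ F ⁻¹' {p}).Finite := fun T hT p hp =>
    (eventually_ncard_fiber_eq hFD hproper
      ((mem_compl_image_criticalSet_union_frontier_iff hD).1 (hT.subset hp))).1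
  have hside : ∀ T, IsImageTile F U D T → y ∈ closure T → ∃ q ∈ T, q ∈ A ∨ q ∈ B := by
    intro T hT hyT
    obtain ⟨q, hq, hqT⟩ := mem_closure_iff_nhds.1 hyT _ hnhds
    exact ⟨q, hqT, hq.resolve_right (hT.subset hqT)⟩
  intro p₁ hp₁ p₂ hp₂
  refine ⟨hfin T₁ hT₁ p₁ hp₁, hfin T₂ hT₂ p₂ hp₂, ?_⟩
  obtain ⟨q₁, hq₁, h₁⟩ := hside T₁ hT₁ hy₁
  obtain ⟨q₂, hq₂, h₂⟩ := hside T₂ hT₂ hy₂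
  rw [hT₁.ncard_fiber_eq hFD hD hproper hp₁ hq₁, hT₂.ncard_fiber_eq hFD hD hproper hp₂ hq₂]
  rcases h₁ with h₁ | h₁ <;> rcases h₂ with h₂ | h₂
  · exact absurd (hT₁.eq_of_isPreconnected hT₂ hA hAc ⟨hq₁, h₁⟩ ⟨hq₂, h₂⟩) hne
  · exact Or.inl (by rw [hAn q₁ h₁, hBn q₂ h₂])
  · exact Or.inr (by rw [hAn q₂ h₂, hBn q₁ h₁])
  · exact absurd (hT₁.eq_of_isPreconnected hT₂ hB hBc ⟨hq₁, h₁⟩ ⟨hq₂, h₂⟩) hne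
end

section
/- Let Y be a real Banach space and Φ : Y → Y a continuous map such that for every closed ball B ⊆ Y the closure of Φ(B) is compact, and define G : Y → Y by G(u) = u + Φ(u). If ‖G(x)‖ → ∞ as ‖x‖ → ∞ (that is, for every M > 0 there is R > 0 such that ‖G(x)‖ ≥ M whenever ‖x‖ ≥ R), then G is proper: the preimage under G of every compact subset of Y is compact. -/
open Set Metric

theorem statement7 {Y : Type*}
    [NormedAddCommGroup Y] [NormedSpace ℝ Y] [CompleteSpace Y]
    (Φ : Y → Y) (hΦcont : Continuous Φ)
    (hΦcpt : ∀ (c : Y) (r : ℝ), IsCompact (closure (Φ '' Metric.closedBall c r)))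
    (G : Y → Y) (hG : ∀ u, G u = u + Φ u)
    (hinf : ∀ M > (0 : ℝ), ∃ R > (0 : ℝ), ∀ x : Y, R ≤ ‖x‖ → M ≤ ‖G x‖) :
    ∀ K : Set Y, IsCompact K → IsCompact (G ⁻¹' K) := by
  intro K hK
  have hGcont : Continuous G := by
    rw [funext hG]
    exact continuous_id.add hΦcont
  obtain ⟨C, hC⟩ := hK.isBounded.exists_norm_le
  obtain ⟨R, -, hR⟩ := hinf (|C| + 1) (by positivity)
  refine ((hK.prod (hΦcpt 0 R)).image continuous_sub).of_isClosed_subset (hK.isClosed.preimage hGcont) fun x hx => ?_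
  have hxR : ‖x‖ ≤ R := by
    by_contra! h
    linarith [hR x h.le, hC (G x) hx, le_abs_self C]
  exact ⟨(G x, Φ x), ⟨hx,
    subset_closure (Set.mem_image_of_mem Φ (mem_closedBall_zero_iff.2 hxR))⟩, by simp [hG]⟩
end
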